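/- Let G be a finite group acting transitively on a nonempty finite set X, and let R be a nonempty transitive binary relation on X that is preserved by the action of G (i.e., x R y implies x^g R y^g for all g in G). Then R is an equivalence relation on X. -/

import Mathlib

/-- If a finite group `G` acts transitively on a nonempty finite set `X` and `R` is a
nonempty transitive binary relation on `X` preserved by `G`, then `R` is an equivalence
relation. -/
theorem stmt_0 {G X : Type*} [Group G] [Finite G] [Finite X] [Nonempty X]
    [MulAction G X] [MulAction.IsPretransitive G X]
    (R : X → X → Prop) (hne : ∃ x y, R x y)
    (htrans : ∀ {x y z : X}, R x y → R y z → R x z)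
    (hpres : ∀ (g : G) {x y : X}, R x y → R (g • x) (g • y)) :
    Equivalence R := by
  have key : ∀ (g : G) (x : X), R x (g • x) → ∀ n : ℕ, R x (g ^ (n + 1) • x) := by
    intro g x h n
    induction n with
    | zero => simpa using h
    | succ n ih =>
      have h2 := hpres (g ^ (n + 1)) h
      rw [smul_smul, ← pow_succ] at h2
      exact htrans ih h2
  have symm : ∀ {x y : X}, R x y → R y x := by
    intro x y h
    obtain ⟨g, rfl⟩ := MulAction.exists_smul_eq G x y
    obtain ⟨k, hk⟩ : ∃ k, orderOf g = k + 1 :=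
      Nat.exists_eq_succ_of_ne_zero (orderOf_pos g).ne'
    have h2 := hpres g (key g x h (2 * k))
    rw [smul_smul, ← pow_succ', show 2 * k + 1 + 1 = orderOf g * 2 by omega, pow_mul,
      pow_orderOf_eq_one, one_pow, one_smul] at h2
    exact h2
  refine ⟨?_, symm, htrans⟩
  intro z
  obtain ⟨x, y, h⟩ := hne
  obtain ⟨g, rfl⟩ := MulAction.exists_smul_eq G x z
  exact hpres g (htrans h (symm h))
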